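/- arXiv:math/0603356 — 3 statements merged into one kernel-verified Lean document; each statement's English description precedes it below -/
import Mathlib

section
/- Let k be a field of characteristic 2, let P be a finite elementary abelian 2-group (so P is a vector space over F₂ = ℤ/2ℤ), and let E be a finite group of odd order acting on P by group automorphisms. Set V = k ⊗_{F₂} P, a k-vector space on which E acts k-linearly via its action on P. Then there exists an isomorphism of k-algebras φ : kP → Λ(V) from the group algebra of P to the exterior algebra of V which is E-equivariant, i.e. φ(e·x) = e·φ(x) for all e ∈ E and x ∈ kP, where E acts on kP by the algebra automorphisms induced functorially from its action on P, and on Λ(V) by the algebra automorphisms induced functorially from its linear action on V. (Consequently the skew group algebras kP⋊E and Λ(V)⋊E are isomorphic.) -/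
open scoped TensorProduct

/-- If `M` is a nilpotent subspace which together with the scalars spans an algebra, then any
subalgebra containing generators of `M` modulo `M * M` is the whole algebra. -/
theorem Subalgebra.eq_top_of_le_sup_mul_self {k A : Type*} [CommSemiring k] [CommSemiring A]
    [Algebra k A] {M S : Submodule k A} (B : Subalgebra k A) (hSB : S ≤ B.toSubmodule)
    (hSM : S ≤ M) (hM : M ≤ S ⊔ M * M) (htop : 1 ⊔ M = ⊤) (hnil : IsNilpotent M) : B = ⊤ := by
  have hpow (n : ℕ) : M ^ n ≤ S ^ n ⊔ M ^ (n + 1) := by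
    induction n with
    | zero => simp
    | succ n ih =>
      calc M ^ (n + 1) = M ^ n * M := pow_succ _ _
        _ ≤ (S ^ n ⊔ M ^ (n + 1)) * M := by gcongr
        _ = S ^ n * M ⊔ M ^ (n + 2) := by rw [Submodule.sup_mul, ← pow_succ]
        _ ≤ S ^ n * (S ⊔ M * M) ⊔ M ^ (n + 2) := by gcongr
        _ = S ^ (n + 1) ⊔ S ^ n * (M * M) ⊔ M ^ (n + 2) := by
          rw [Submodule.mul_sup, ← pow_succ]
        _ ≤ S ^ (n + 1) ⊔ M ^ n * (M * M) ⊔ M ^ (n + 2) := by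
          gcongr
        _ = S ^ (n + 1) ⊔ M ^ (n + 2) := by
          rw [sup_assoc, show M ^ n * (M * M) = M ^ (n + 2) by ring, sup_idem]
  have hSBpow (n : ℕ) : S ^ n ≤ B.toSubmodule := by
    induction n with
    | zero => exact Submodule.one_le.2 B.one_mem
    | succ n ih =>
      rw [pow_succ, Submodule.mul_le]
      exact fun x hx y hy => B.mul_mem (ih hx) (hSB hy)
  have hB (n : ℕ) : ⊤ ≤ B.toSubmodule ⊔ M ^ (n + 1) := by
    induction n with
    | zero =>
      rw [← htop, zero_add, pow_one]
      exact sup_le_sup_right (Submodule.one_le.2 B.one_mem) _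
    | succ n ih =>
      exact ih.trans (sup_le le_sup_left ((hpow _).trans (sup_le_sup_right (hSBpow _) _)))
  obtain ⟨n, hn⟩ := hnil
  have h := hB n
  rw [pow_succ, hn, zero_mul, Submodule.zero_eq_bot, sup_bot_eq] at h
  exact Algebra.toSubmodule_eq_top.1 (top_le_iff.1 h)

namespace AddMonoidAlgebra

variable (k P : Type*) [Field k] [AddCommGroup P]

/-- The augmentation ideal of a group algebra, as a subspace. -/
noncomputable def augmentationSubmodule : Submodule k (AddMonoidAlgebra k P) :=
  Submodule.span k (Set.range fun x : P => single x (1 : k) - 1)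

variable {k P}

theorem single_sub_one_mem_augmentationSubmodule (x : P) :
    single x (1 : k) - 1 ∈ augmentationSubmodule k P :=
  Submodule.subset_span ⟨x, rfl⟩

theorem one_sup_augmentationSubmodule : 1 ⊔ augmentationSubmodule k P = ⊤ := by
  rw [eq_top_iff, ← (AddMonoidAlgebra.basis P k).span_eq, Submodule.span_le]
  rintro _ ⟨x, rfl⟩
  rw [AddMonoidAlgebra.basis_apply, ← add_sub_cancel (1 : AddMonoidAlgebra k P) (single x 1)]
  exact Submodule.add_mem_sup (Submodule.one_le.1 le_rfl)
    (single_sub_one_mem_augmentationSubmodule x)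

theorem map_domCongr_augmentationSubmodule_le (f : P ≃+ P) :
    (augmentationSubmodule k P).map (domCongr k k f).toAlgHom.toLinearMap ≤
      augmentationSubmodule k P := by
  refine (Submodule.map_span_le _ _ _).2 ?_
  rintro _ ⟨x, rfl⟩
  simpa using single_sub_one_mem_augmentationSubmodule (k := k) (f x)

theorem domCongr_mem_augmentationSubmodule (f : P ≃+ P) {a : AddMonoidAlgebra k P}
    (ha : a ∈ augmentationSubmodule k P) : domCongr k k f a ∈ augmentationSubmodule k P :=
  map_domCongr_augmentationSubmodule_le f ⟨a, ha, rfl⟩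

theorem domCongr_mem_augmentationSubmodule_mul_self (f : P ≃+ P) {a : AddMonoidAlgebra k P}
    (ha : a ∈ augmentationSubmodule k P * augmentationSubmodule k P) :
    domCongr k k f a ∈ augmentationSubmodule k P * augmentationSubmodule k P := by
  have h := Submodule.mem_map_of_mem (f := (domCongr k k f).toAlgHom.toLinearMap) ha
  rw [Submodule.map_mul] at h
  exact mul_le_mul' (map_domCongr_augmentationSubmodule_le f)
    (map_domCongr_augmentationSubmodule_le f) h

section ElementaryAbelian

variable [Module (ZMod 2) P]

theorem mul_self_eq_zero_of_mem_augmentationSubmodule [CharP k 2] {a : AddMonoidAlgebra k P}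
    (ha : a ∈ augmentationSubmodule k P) : a * a = 0 := by
  have : CharP (AddMonoidAlgebra k P) 2 := charP_of_injective_algebraMap' k 2
  induction ha using Submodule.span_induction with
  | mem _ h =>
    obtain ⟨x, rfl⟩ := h
    dsimp only
    rw [← pow_two, CharTwo.sub_eq_add, CharTwo.add_sq, single_pow, one_pow, one_pow,
      two_nsmul, ZModModule.add_self, ← one_def, CharTwo.add_self_eq_zero]
  | zero => simp
  | add a b _ _ ha hb => rw [CharTwo.add_mul_self, ha, hb, add_zero]
  | smul c a _ ha => rw [smul_mul_smul_comm, ha, smul_zero]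

theorem isNilpotent_augmentationSubmodule [CharP k 2] [Finite P] :
    IsNilpotent (augmentationSubmodule k P) := by
  have : Module.Finite k (AddMonoidAlgebra k P) := .of_basis (AddMonoidAlgebra.basis P k)
  have : IsNoetherianRing (AddMonoidAlgebra k P) := isNoetherian_of_tower k inferInstance
  obtain ⟨n, hn⟩ := IsNoetherianRing.isNilpotent_nilradical (AddMonoidAlgebra k P)
  have h (m : ℕ) : augmentationSubmodule k P ^ m ≤
      (nilradical (AddMonoidAlgebra k P) ^ m).restrictScalars k := by
    induction m with
    | zero => simp
    | succ m ih =>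
      rw [pow_succ, pow_succ, Submodule.mul_le]
      exact fun a ha b hb => Ideal.mul_mem_mul (ih ha)
        (mem_nilradical.2 ⟨2, by rw [pow_two, mul_self_eq_zero_of_mem_augmentationSubmodule hb]⟩)
  refine ⟨n, le_bot_iff.1 ((h n).trans ?_)⟩
  rw [hn]
  simp

variable [Algebra (ZMod 2) k]

/-- There is an additive map `P → I` lifting the canonical map `P → I / I²`, where `I` is the
augmentation ideal. -/
theorem exists_linearMap_augmentationSubmodule : ∃ t : P →ₗ[ZMod 2] AddMonoidAlgebra k P, ∀ x,
    t x ∈ augmentationSubmodule k P ∧ t x - (single x 1 - 1) ∈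
      augmentationSubmodule k P * augmentationSubmodule k P := by
  let b := Module.Free.chooseBasis (ZMod 2) P
  let t : P →ₗ[ZMod 2] AddMonoidAlgebra k P := b.constr ℕ fun i => single (b i) 1 - 1
  have ht (i) : t (b i) = single (b i) 1 - 1 := b.constr_basis _ _ _
  let q := (augmentationSubmodule k P * augmentationSubmodule k P).mkQ
  let u : P →+ AddMonoidAlgebra k P ⧸
      (augmentationSubmodule k P * augmentationSubmodule k P) :=
    AddMonoidHom.mk' (fun x => q (single x 1 - 1)) fun x y => by
      rw [← map_add, ← sub_eq_zero, ← map_sub, Submodule.mkQ_apply, Submodule.Quotient.mk_eq_zero]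
      convert Submodule.mul_mem_mul (single_sub_one_mem_augmentationSubmodule (k := k) x)
        (single_sub_one_mem_augmentationSubmodule (k := k) y) using 1
      rw [← mul_one (1 : k), ← single_mul_single]
      simp only [mul_one]
      ring
  have hu : (q.restrictScalars (ZMod 2)).comp t = AddMonoidHom.toZModLinearMap 2 u :=
    b.ext fun i => by simp [ht, u]
  refine ⟨t, fun x => ⟨?_, ?_⟩⟩
  · have h : ⊤ ≤ ((augmentationSubmodule k P).restrictScalars (ZMod 2)).comap t := by
      rw [← b.span_eq, Submodule.span_le]
      rintro _ ⟨i, rfl⟩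
      simpa [ht] using single_sub_one_mem_augmentationSubmodule (k := k) (b i)
    exact h trivial
  · have h := LinearMap.congr_fun hu x
    rw [← Submodule.Quotient.mk_eq_zero, ← Submodule.mkQ_apply, map_sub, sub_eq_zero]
    exact h

/-- For an odd order group acting on `P`, the canonical map `P → I / I²` lifts to an equivariant
map `P → I`, where `I` is the augmentation ideal. -/
theorem exists_equivariant_linearMap_augmentationSubmodule [CharP k 2] {E : Type*}
    [Group E] [Finite E] (hE : Odd (Nat.card E)) [DistribMulAction E P] :
    ∃ t : P →ₗ[ZMod 2] AddMonoidAlgebra k P,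
      (∀ x, t x ∈ augmentationSubmodule k P) ∧
      (∀ x, t x - (single x 1 - 1) ∈ augmentationSubmodule k P * augmentationSubmodule k P) ∧
      ∀ (e : E) x, t (e • x) = domCongr k k (DistribMulAction.toAddEquiv P e) (t x) := by
  have := Fintype.ofFinite E
  obtain ⟨t, ht⟩ := exists_linearMap_augmentationSubmodule (k := k) (P := P)
  let σ (e : E) := domCongr k k (DistribMulAction.toAddEquiv P e)
  let T : P →+ AddMonoidAlgebra k P :=
    ∑ e : E, (σ e).toAlgHom.toLinearMap.toAddMonoidHom.comp
      (t.toAddMonoidHom.comp (DistribSMul.toAddMonoidHom P e⁻¹))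
  have hT (x) : T x = ∑ e : E, σ e (t (e⁻¹ • x)) := by
    simp [T]
  have hσ (e f : E) (a) : σ e (σ f a) = σ (e * f) a := by
    induction a using AddMonoidAlgebra.induction_linear with
    | zero => simp
    | add a b ha hb => simp only [map_add, ha, hb]
    | single x c => simp [σ, mul_smul]
  have hcard : ((Fintype.card E : ℕ) : AddMonoidAlgebra k P) = 1 := by
    have : CharP (AddMonoidAlgebra k P) 2 := charP_of_injective_algebraMap' k 2
    rw [← Nat.card_eq_fintype_card]
    obtain ⟨m, hm⟩ := hE
    rw [hm]
    simp [CharTwo.two_eq_zero]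
  refine ⟨AddMonoidHom.toZModLinearMap 2 T, fun x => ?_, fun x => ?_, fun e x => ?_⟩
  · rw [AddMonoidHom.coe_toZModLinearMap, hT]
    exact Submodule.sum_mem _ fun e _ => domCongr_mem_augmentationSubmodule _ (ht _).1
  · rw [AddMonoidHom.coe_toZModLinearMap, hT]
    have h : single x (1 : k) - 1 = ∑ e : E, σ e (single (e⁻¹ • x) 1 - 1) := by
      have (e : E) : σ e (single (e⁻¹ • x) 1 - 1) = single x (1 : k) - 1 := by
        simp [σ]
      rw [Finset.sum_congr rfl fun e _ => this e, Finset.sum_const, Finset.card_univ,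
        nsmul_eq_mul, hcard, one_mul]
    rw [h, ← Finset.sum_sub_distrib]
    refine Submodule.sum_mem _ fun e _ => ?_
    rw [← map_sub]
    exact domCongr_mem_augmentationSubmodule_mul_self _ (ht _).2
  · rw [AddMonoidHom.coe_toZModLinearMap, hT, hT]
    change _ = σ e _
    rw [map_sum]
    refine (Fintype.sum_equiv (Equiv.mulLeft e) _ _ fun f => ?_).symm
    rw [hσ, Equiv.coe_mulLeft, mul_inv_rev, mul_smul, inv_smul_smul]

end ElementaryAbelian

end AddMonoidAlgebra

theorem ExteriorAlgebra.finrank_eq {k V : Type*} [Field k] [AddCommGroup V] [Module k V]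
    [FiniteDimensional k V] :
    Module.finrank k (ExteriorAlgebra k V) = 2 ^ Module.finrank k V := by
  rw [Module.finrank_eq_card_basis (Module.finBasis k V).ExteriorAlgebra]
  simp

instance ExteriorAlgebra.finiteDimensional {k V : Type*} [Field k] [AddCommGroup V] [Module k V]
    [FiniteDimensional k V] : FiniteDimensional k (ExteriorAlgebra k V) :=
  .of_basis (Module.finBasis k V).ExteriorAlgebra

theorem AddMonoidAlgebra.finrank_eq_finrank_exteriorAlgebra (k P : Type*) [Field k]
    [AddCommGroup P] [Finite P] [Module (ZMod 2) P] [Algebra (ZMod 2) k] :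
    Module.finrank k (AddMonoidAlgebra k P) =
      Module.finrank k (ExteriorAlgebra k (k ⊗[ZMod 2] P)) := by
  have := Fintype.ofFinite P
  rw [ExteriorAlgebra.finrank_eq, Module.finrank_baseChange,
    Module.finrank_eq_card_basis (AddMonoidAlgebra.basis P k),
    Module.card_eq_pow_finrank (K := ZMod 2), ZMod.card]

open scoped TensorProduct

/-- Let `k` be a field of characteristic `2`, `P` a finite elementary abelian `2`-group
(canonically an `F₂ = ℤ/2`-module), and `E` a finite group of odd order acting on `P` by
group automorphisms.  Let `V = k ⊗_{F₂} P`.  Then there is an `E`-equivariant isomorphism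
of `k`-algebras `kP ≃ Λ(V)` between the group algebra of `P` and the exterior algebra
of `V`, where `e ∈ E` acts on `kP` by the algebra automorphism functorially induced from
its action on `P`, and on `Λ(V)` by the algebra automorphism functorially induced from
its `k`-linear action on `V`.  (Hence `kP ⋊ E ≅ Λ(V) ⋊ E`.) -/
theorem groupAlgebra_iso_exteriorAlgebra_equivariant
    (k : Type) [Field k] [CharP k 2]
    (P : Type) [AddCommGroup P] [Finite P] [Module (ZMod 2) P]
    (E : Type) [Group E] [Finite E] (hE : Odd (Nat.card E))
    [DistribMulAction E P] :
    letI : Algebra (ZMod 2) k := ZMod.algebra k 2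
    ∃ φ : AddMonoidAlgebra k P ≃ₐ[k] ExteriorAlgebra k (k ⊗[ZMod 2] P),
      ∀ (e : E) (x : AddMonoidAlgebra k P),
        φ (AddMonoidAlgebra.domCongr k k (DistribMulAction.toAddEquiv P e) x) =
          ExteriorAlgebra.map
            (LinearMap.baseChange k
              (AddMonoidHom.toZModLinearMap 2 (DistribMulAction.toAddMonoidHom P e)))
            (φ x) := by
  let : Algebra (ZMod 2) k := ZMod.algebra k 2
  obtain ⟨t, htM, htsq, htE⟩ :=
    AddMonoidAlgebra.exists_equivariant_linearMap_augmentationSubmodule (k := k) (P := P) hE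
  let M := AddMonoidAlgebra.augmentationSubmodule k P
  let s : k ⊗[ZMod 2] P →ₗ[k] AddMonoidAlgebra k P := t.liftBaseChange k
  have hs (x : P) : s (1 ⊗ₜ x) = t x := by simp [s]
  have hsM : LinearMap.range s ≤ M := by
    rintro _ ⟨v, rfl⟩
    induction v with
    | zero => simp
    | add v w hv hw => rw [map_add]; exact M.add_mem hv hw
    | tmul c x => simpa [s] using M.smul_mem c (htM x)
  let ψ : ExteriorAlgebra k (k ⊗[ZMod 2] P) →ₐ[k] AddMonoidAlgebra k P :=
    ExteriorAlgebra.lift k ⟨s, fun v =>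
      AddMonoidAlgebra.mul_self_eq_zero_of_mem_augmentationSubmodule (hsM ⟨v, rfl⟩)⟩
  have hψι (v) : ψ (ExteriorAlgebra.ι k v) = s v := by simp [ψ]
  have hrange : ψ.range = ⊤ := by
    refine ψ.range.eq_top_of_le_sup_mul_self (M := M) (S := LinearMap.range s) ?_ hsM ?_
      AddMonoidAlgebra.one_sup_augmentationSubmodule
      AddMonoidAlgebra.isNilpotent_augmentationSubmodule
    · rintro _ ⟨v, rfl⟩
      exact ⟨ExteriorAlgebra.ι k v, hψι v⟩
    · refine Submodule.span_le.2 ?_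
      rintro _ ⟨x, rfl⟩
      refine Submodule.mem_sup.2 ⟨t x, ⟨1 ⊗ₜ x, hs x⟩, _, neg_mem (htsq x), by simp⟩
  have hsurj : Function.Surjective ψ := AlgHom.range_eq_top ψ |>.1 hrange
  have hinj : Function.Injective ψ :=
    have : Module.Finite k (AddMonoidAlgebra k P) := .of_basis (AddMonoidAlgebra.basis P k)
    (LinearMap.injective_iff_surjective_of_finrank_eq_finrank (f := ψ.toLinearMap)
      (AddMonoidAlgebra.finrank_eq_finrank_exteriorAlgebra k P).symm).2 hsurj
  let Ψ := AlgEquiv.ofBijective ψ ⟨hinj, hsurj⟩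
  have hequiv (e : E) :
      ψ.comp (ExteriorAlgebra.map (LinearMap.baseChange k
        (AddMonoidHom.toZModLinearMap 2 (DistribMulAction.toAddMonoidHom P e)))) =
      (AddMonoidAlgebra.domCongr k k (DistribMulAction.toAddEquiv P e)).toAlgHom.comp ψ := by
    ext x
    simp [hψι, hs, htE]
  refine ⟨Ψ.symm, fun e x => ?_⟩
  obtain ⟨y, rfl⟩ := Ψ.surjective x
  rw [AlgEquiv.symm_apply_apply, AlgEquiv.symm_apply_eq]
  exact (DFunLike.congr_fun (hequiv e) y).symm
end

section
/- Let ℓ be a prime, k a field of characteristic ℓ, Q a finite ℓ-group, and Ω a Q-set. Let M = kΩ be the permutation module (the free k-module on Ω with Q permuting the basis), let M^Q ⊆ M be the submodule of Q-invariant elements, and let M_Q = M/N be the module of coinvariants, where N is the k-submodule of M spanned by all elements q·m − m with q ∈ Q, m ∈ M; let π : M → M_Q be the quotient map. Then the family (π(ω))_{ω ∈ Ω^Q}, indexed by the Q-fixed points of Ω, is k-linearly independent in M_Q, and its k-span equals π(M^Q). Consequently the Brauer construction Br_Q(kΩ), defined as the image of M^Q in M_Q, is isomorphic as a k-module to the free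 k-module k(Ω^Q) on the fixed-point set Ω^Q. -/
section Brauer

variable (ℓ : ℕ) (k : Type) [Field k] (Q : Type) [Group Q] (Ω : Type) [MulAction Q Ω]

/-- The action of `q ∈ Q` on the permutation module `kΩ`, as a `k`-linear map. -/
noncomputable def permAction (q : Q) : (Ω →₀ k) →ₗ[k] (Ω →₀ k) :=
  Finsupp.lmapDomain k k (q • ·)

/-- The submodule of `Q`-invariants `M^Q` of the permutation module `M = kΩ`. -/
noncomputable def permInvariants : Submodule k (Ω →₀ k) :=
  ⨅ q : Q, LinearMap.ker (permAction k Q Ω q - LinearMap.id)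

/-- The submodule of `M = kΩ` spanned by the elements `q • m - m` (`q ∈ Q`, `m ∈ M`),
so that `M_Q = M ⧸ permRelations` is the module of coinvariants. -/
noncomputable def permRelations : Submodule k (Ω →₀ k) :=
  ⨆ q : Q, LinearMap.range (permAction k Q Ω q - LinearMap.id)

end Brauer

section BrauerLemmas

variable {k : Type} [Field k] {Q : Type} [Group Q] {Ω : Type} [MulAction Q Ω]

lemma permAction_apply (q : Q) (m : Ω →₀ k) (ω : Ω) :
    permAction k Q Ω q m ω = m (q⁻¹ • ω) := by
  have h := Finsupp.mapDomain_apply (MulAction.injective q) m (q⁻¹ • ω)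
  rwa [smul_inv_smul] at h

lemma permAction_single (q : Q) (ω : Ω) (c : k) :
    permAction k Q Ω q (Finsupp.single ω c) = Finsupp.single (q • ω) c :=
  Finsupp.mapDomain_single

lemma mem_permInvariants_iff {m : Ω →₀ k} :
    m ∈ permInvariants k Q Ω ↔ ∀ (q : Q) (ω : Ω), m (q • ω) = m ω := by
  simp only [permInvariants, Submodule.mem_iInf, LinearMap.mem_ker, LinearMap.sub_apply,
    LinearMap.id_apply, sub_eq_zero, Finsupp.ext_iff, permAction_apply]
  exact ⟨fun h q ω => by simpa using h q⁻¹ ω, fun h q ω => h q⁻¹ ω⟩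

lemma mkQ_permRelations_single_smul (q : Q) (ω : Ω) (c : k) :
    (permRelations k Q Ω).mkQ (Finsupp.single (q • ω) c) =
      (permRelations k Q Ω).mkQ (Finsupp.single ω c) := by
  rw [← permAction_single, ← sub_eq_zero, ← map_sub, Submodule.mkQ_apply,
    Submodule.Quotient.mk_eq_zero]
  exact Submodule.mem_iSup_of_mem q ⟨Finsupp.single ω c, rfl⟩

lemma permRelations_le_ker_restrict :
    permRelations k Q Ω ≤ LinearMap.ker
      (Finsupp.lcomapDomain (R := k) (M := k) (Subtype.val : MulAction.fixedPoints Q Ω → Ω)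
        Subtype.val_injective) := by
  refine iSup_le fun q => ?_
  rintro _ ⟨m, rfl⟩
  ext ⟨ω, hω⟩
  change permAction k Q Ω q m ω - m ω = 0
  rw [permAction_apply, hω q⁻¹, sub_self]

variable (k Q Ω) in
lemma linearIndependent_mkQ_single_fixedPoints :
    LinearIndependent k
      (fun ω : MulAction.fixedPoints Q Ω =>
        (permRelations k Q Ω).mkQ (Finsupp.single (ω : Ω) (1 : k))) := by
  refine LinearIndependent.of_comp
    ((permRelations k Q Ω).liftQ _ permRelations_le_ker_restrict) ?_
  convert Finsupp.linearIndependent_single_one k (MulAction.fixedPoints Q Ω) using 1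
  · exact funext fun ω => Finsupp.comapDomain_single Subtype.val ω 1 Subtype.val_injective.injOn
  · rfl

lemma mkQ_mem_span_of_mem_permInvariants {ℓ : ℕ} [Fact ℓ.Prime] [CharP k ℓ] [Finite Q]
    (hQ : IsPGroup ℓ Q) {m : Ω →₀ k} (hm : m ∈ permInvariants k Q Ω) :
    (permRelations k Q Ω).mkQ m ∈ Submodule.span k
      (Set.range (fun ω : MulAction.fixedPoints Q Ω =>
        (permRelations k Q Ω).mkQ (Finsupp.single (ω : Ω) (1 : k)))) := by
  classical
  rw [mem_permInvariants_iff] at hm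
  rw [← m.sum_single, Finsupp.sum, map_sum]
  rw [← Finset.sum_fiberwise_of_maps_to
    (fun ω hω => Finset.mem_image_of_mem (MulAction.orbit Q) hω)]
  refine Submodule.sum_mem _ fun O hO => ?_
  obtain ⟨a, ha, rfl⟩ := Finset.mem_image.mp hO
  have hfiber : ((m.support.filter fun ω => MulAction.orbit Q ω = MulAction.orbit Q a : Finset Ω) :
      Set Ω) = MulAction.orbit Q a := by
    ext ω
    simp only [Finset.coe_filter, Set.mem_ofPred_eq, MulAction.orbit_eq_iff]
    refine and_iff_right_of_imp ?_
    rintro ⟨q, rfl⟩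
    simpa [hm] using ha
  have hconst : ∀ ω ∈ m.support.filter fun ω => MulAction.orbit Q ω = MulAction.orbit Q a,
      (permRelations k Q Ω).mkQ (Finsupp.single ω (m ω)) =
        (permRelations k Q Ω).mkQ (Finsupp.single a (m a)) := by
    intro ω hω
    rw [← Finset.mem_coe, hfiber] at hω
    obtain ⟨q, rfl⟩ := hω
    simp only [hm, mkQ_permRelations_single_smul]
  rw [Finset.sum_congr rfl hconst, Finset.sum_const, ← Set.ncard_coe_finset, hfiber]
  have : Finite (MulAction.orbit Q a) := (Set.finite_range _).to_subtype
  obtain ⟨n, hn⟩ := hQ.card_orbit a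
  rw [Nat.card_coe_set_eq] at hn
  rcases n with _ | n
  · have hfix : a ∈ MulAction.fixedPoints Q Ω := by
      rw [pow_zero, Set.ncard_eq_one] at hn
      obtain ⟨b, hb⟩ := hn
      intro q
      have h₁ : q • a ∈ MulAction.orbit Q a := MulAction.mem_orbit a q
      have h₂ : a ∈ MulAction.orbit Q a := MulAction.mem_orbit_self a
      rw [hb, Set.mem_singleton_iff] at h₁ h₂
      rw [h₁, ← h₂]
    refine Submodule.smul_of_tower_mem _ _ ?_
    rw [← Finsupp.smul_single_one, map_smul]
    exact Submodule.smul_mem _ _ (Submodule.subset_span ⟨⟨a, hfix⟩, rfl⟩)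
  · rw [hn, ← Nat.cast_smul_eq_nsmul k, Nat.cast_pow, CharP.cast_eq_zero, zero_pow n.succ_ne_zero,
      zero_smul]
    exact Submodule.zero_mem _

lemma single_mem_permInvariants {ω : Ω} (hω : ω ∈ MulAction.fixedPoints Q Ω) (c : k) :
    Finsupp.single ω c ∈ permInvariants k Q Ω := by
  simp only [permInvariants, Submodule.mem_iInf, LinearMap.mem_ker, LinearMap.sub_apply,
    LinearMap.id_apply, permAction_single]
  intro q
  rw [hω q, sub_self]

end BrauerLemmas

/-- **The Brauer construction on permutation modules.**
Let `ℓ` be a prime, `k` a field of characteristic `ℓ`, `Q` a finite `ℓ`-group and `Ω` a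
`Q`-set.  Let `M = kΩ`, let `π : M → M_Q` be the projection onto the coinvariants.  Then
the images `π(ω)`, for `ω` a `Q`-fixed point of `Ω`, are `k`-linearly independent in
`M_Q`, and their span is exactly the image `π(M^Q)` of the invariants.  Consequently
`Br_Q(kΩ) = π(M^Q)` is a free `k`-module on the fixed points: `Br_Q(kΩ) ≅ k(Ω^Q)`. -/
theorem brauer_construction_of_permutation_module
    (ℓ : ℕ) (hℓ : ℓ.Prime) (k : Type) [Field k] [CharP k ℓ]
    (Q : Type) [Group Q] [Finite Q] (hQ : IsPGroup ℓ Q)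
    (Ω : Type) [MulAction Q Ω] :
    LinearIndependent k
      (fun ω : MulAction.fixedPoints Q Ω =>
        (permRelations k Q Ω).mkQ (Finsupp.single (ω : Ω) (1 : k))) ∧
    Submodule.span k
        (Set.range (fun ω : MulAction.fixedPoints Q Ω =>
          (permRelations k Q Ω).mkQ (Finsupp.single (ω : Ω) (1 : k)))) =
      Submodule.map (permRelations k Q Ω).mkQ (permInvariants k Q Ω) ∧
    Nonempty
      ((Submodule.map (permRelations k Q Ω).mkQ (permInvariants k Q Ω)) ≃ₗ[k]
        (MulAction.fixedPoints Q Ω →₀ k)) := by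
  have : Fact ℓ.Prime := ⟨hℓ⟩
  have hli := linearIndependent_mkQ_single_fixedPoints k Q Ω
  have hspan : Submodule.span k
      (Set.range (fun ω : MulAction.fixedPoints Q Ω =>
        (permRelations k Q Ω).mkQ (Finsupp.single (ω : Ω) (1 : k)))) =
      Submodule.map (permRelations k Q Ω).mkQ (permInvariants k Q Ω) := by
    apply le_antisymm
    · rw [Submodule.span_le]
      rintro _ ⟨ω, rfl⟩
      exact Submodule.mem_map_of_mem (single_mem_permInvariants ω.2 1)
    · rw [Submodule.map_le_iff_le_comap]
      exact fun m hm => mkQ_mem_span_of_mem_permInvariants hQ hm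
  exact ⟨hli, hspan, ⟨(LinearEquiv.ofEq _ _ hspan).symm.trans hli.linearCombinationEquiv.symm⟩⟩
end

section
/- Let ℓ be a prime, k a field of characteristic ℓ, and n ≥ 1. Let S_n be the symmetric group on {1, …, n}, regard S_{n−1} ≤ S_n as the stabilizer of the letter n, and let X_n = (1,n) + (2,n) + ⋯ + (n−1,n) ∈ kS_n be the Jucys–Murphy element (the sum of the transpositions exchanging n with a smaller letter). Let M be a finite-dimensional kS_n-module. Then: (a) the k-linear operator x_M : m ↦ X_n·m on M commutes with the action of every element of S_{n−1}; (b) M decomposes as the direct sum, over a ∈ F_ℓ (the prime subfield of k), of the generalized eigenspaces M_a = ⋃_{r ≥ 1} ker((x_M − a·id)^r), i.e. every generalized eigenvalue of x_M on M lies in the prime subfield; and (c) each M_a is a kS_{n−1}-submodule of M. (This gives the decomposition Res^{S_n}_{S_{n−1}} = ⊕_{a ∈ F_ℓ} F_a underlying the affine Lie algebra action on the representation theory of symmetric groups.) -/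
open Equiv

open Polynomial in
/-- If a product of powers of distinct linear factors annihilates `f`, then the corresponding
generalized eigenspaces span. -/
theorem ker_aeval_prod_X_sub_C_pow_le_iSup_maxGenEigenspace {k M ι : Type*} [Field k]
    [AddCommGroup M] [Module k M] (f : Module.End k M) {c : ι → k} (hc : Function.Injective c)
    (N : ℕ) (s : Finset ι) :
    LinearMap.ker (aeval f (∏ a ∈ s, (X - C (c a)) ^ N)) ≤
      ⨆ a, f.maxGenEigenspace (c a) := by
  classical
  induction s using Finset.induction_on with
  | empty =>
    intro v hv
    have : v = 0 := by simpa using hv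
    simp [this]
  | insert a s ha ih =>
    rw [Finset.prod_insert ha, ← sup_ker_aeval_eq_ker_aeval_mul_of_coprime]
    · refine sup_le (fun v hv ↦ ?_) ih
      refine Submodule.mem_iSup_of_mem a (Module.End.mem_maxGenEigenspace f (c a) v |>.2 ⟨N, ?_⟩)
      simpa [Algebra.algebraMap_eq_smul_one] using hv
    · refine IsCoprime.prod_right fun b hb ↦ IsCoprime.pow ?_
      exact pairwise_coprime_X_sub_C hc fun h ↦ ha (h ▸ hb)

open Polynomial in
/-- An endomorphism `f` with `f ^ ℓ - f` nilpotent decomposes the space into generalized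
eigenspaces for eigenvalues in the prime field. -/
theorem isInternal_maxGenEigenspace_of_isNilpotent_pow_sub {k M : Type*} [Field k]
    [AddCommGroup M] [Module k M] (ℓ : ℕ) [Fact ℓ.Prime] [CharP k ℓ] (f : Module.End k M)
    (hf : IsNilpotent (f ^ ℓ - f)) :
    DirectSum.IsInternal fun a : ZMod ℓ ↦
      f.maxGenEigenspace (ZMod.castHom (dvd_refl ℓ) k a) := by
  have hinj : Function.Injective (ZMod.castHom (dvd_refl ℓ) k) := RingHom.injective _
  refine DirectSum.isInternal_submodule_of_iSupIndep_of_iSup_eq_top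
    (f.independent_maxGenEigenspace.comp hinj) (top_le_iff.1 ?_)
  obtain ⟨N, hN⟩ := hf
  refine le_trans ?_ (ker_aeval_prod_X_sub_C_pow_le_iSup_maxGenEigenspace f hinj N Finset.univ)
  have hprod : ∏ a : ZMod ℓ, (X - C (ZMod.castHom (dvd_refl ℓ) k a)) = (X ^ ℓ - X : k[X]) := by
    have hroots := FiniteField.roots_X_pow_card_sub_X (ZMod ℓ)
    rw [ZMod.card] at hroots
    have hdeg := FiniteField.X_pow_card_sub_X_natDegree_eq (ZMod ℓ) (Fact.out : ℓ.Prime).one_lt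
    have hmonic : (X ^ ℓ - X : (ZMod ℓ)[X]).Monic :=
      monic_X_pow_sub (by simpa using (Fact.out : ℓ.Prime).one_lt)
    have h := congrArg (Polynomial.map (ZMod.castHom (dvd_refl ℓ) k))
      (prod_multiset_X_sub_C_of_monic_of_roots_card_eq hmonic
        (by rw [hroots, hdeg]; simp [ZMod.card]))
    rw [hroots] at h
    change Polynomial.map _ (∏ a : ZMod ℓ, (X - C a)) = _ at h
    simpa [Polynomial.map_prod] using h
  rw [Finset.prod_pow, hprod]
  simp [hN]

open Polynomial in
/-- The rank one degenerate affine Hecke relation `y = s x s + s` propagates nilpotency of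
`x ^ ℓ - x` to `y ^ ℓ - y` in characteristic `ℓ`. -/
theorem isNilpotent_pow_sub_of_degenerate_hecke (k : Type*) {A : Type*} [Field k] [Ring A]
    [Algebra k A] (ℓ : ℕ) [Fact ℓ.Prime] [CharP k ℓ] {x y s : A} (hxy : Commute x y)
    (hs : s * s = 1) (hy : y = s * x * s + s) (hx : IsNilpotent (x ^ ℓ - x)) :
    IsNilpotent (y ^ ℓ - y) := by
  nontriviality A
  have : CharP A ℓ := charP_of_injective_algebraMap (algebraMap k A).injective ℓ
  have hys : y * s = s * x + 1 := by
    rw [hy, add_mul, mul_assoc, hs, mul_one]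
  have hsy : s * y = x * s + 1 := by
    rw [hy, mul_add, ← mul_assoc, ← mul_assoc, hs, one_mul]
  set d := y - x with hd
  set p := x ^ ℓ - x with hp
  set q := y ^ ℓ - y with hq
  have hdx : Commute d x := hxy.symm.sub_left (Commute.refl x)
  have hpq : Commute p q :=
    ((hxy.pow_pow ℓ ℓ).sub_right (hxy.pow_left ℓ)).sub_left
      ((hxy.pow_right ℓ).sub_right hxy)
  -- The intertwiner of `x` and `y`.
  set u := d * s - 1 with hu
  have hux : SemiconjBy u y x := by
    change u * y = x * u
    rw [hu, sub_mul, mul_assoc, hsy, mul_sub, ← mul_assoc x d s, ← hdx.eq, hd]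
    noncomm_ring
  have hsd : s * d = 2 - d * s := by
    rw [hd, mul_sub, sub_mul, hsy, hys, ← one_add_one_eq_two]
    abel
  have huu : u * u = 1 - d * d := by
    have h : d * s * (d * s) = 2 * (d * s) - d * d := by
      calc d * s * (d * s) = d * (s * d) * s := by noncomm_ring
        _ = 2 * (d * s) - d * d * (s * s) := by rw [hsd]; noncomm_ring
        _ = _ := by rw [hs, mul_one]
    calc u * u = d * s * (d * s) - 2 * (d * s) + 1 := by rw [hu]; noncomm_ring
      _ = _ := by rw [h]; noncomm_ring
  obtain ⟨N, hN⟩ := hx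
  have huq : u * q ^ N = 0 := by
    have h : SemiconjBy u (q ^ N) (p ^ N) := ((hux.pow_right ℓ).sub_right hux).pow_right N
    rw [h.eq, hN, zero_mul]
  have hdqN : (1 - d * d) * q ^ N = 0 := by
    rw [← huu, mul_assoc, huq, mul_zero]
  have hr : d ^ ℓ - d = q - p := by
    rw [hd, sub_pow_char_of_commute ℓ hxy.symm]
    simp only [hp, hq]
    abel
  have hdvd : (X - C (1 : k)) * (X - C (-1)) ∣ (X ^ ℓ - X : k[X]) * (X ^ ℓ - X) := by
    refine mul_dvd_mul (dvd_iff_isRoot.2 ?_) (dvd_iff_isRoot.2 ?_)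
    · simp
    · simp [neg_one_pow_char]
  obtain ⟨W, hW⟩ := hdvd
  have hrr : (q - p) * (q - p) = - (aeval d W * (1 - d * d)) := by
    have h := congrArg (aeval d) (hW.trans (mul_comm _ _))
    simp only [map_mul, map_sub, map_pow, aeval_X, map_one, map_neg, hr] at h
    rw [h]
    noncomm_ring
  have hrq : (q - p) ^ 2 * q ^ N = 0 := by
    rw [pow_two, hrr, neg_mul, mul_assoc, hdqN, mul_zero, neg_zero]
  have hcomm : Commute (q - p) q := (Commute.refl q).sub_left hpq
  have hnil : IsNilpotent ((q - p) * q) := by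
    refine ⟨N + 2, ?_⟩
    rw [hcomm.mul_pow, pow_add (q - p), pow_add q, mul_assoc, ← mul_assoc _ (q ^ N), hrq]
    simp
  have hnil' : IsNilpotent (p * q) := hpq.isNilpotent_mul_right ⟨N, hN⟩
  have hsq : IsNilpotent (q ^ 2) := by
    have h : q ^ 2 = (q - p) * q + p * q := by noncomm_ring
    rw [h]
    refine Commute.isNilpotent_add ?_ hnil hnil'
    exact ((hpq.symm.sub_left (Commute.refl p)).mul_right hcomm).mul_left
      (hpq.symm.mul_right (Commute.refl q))
  obtain ⟨K, hK⟩ := hsq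
  exact ⟨2 * K, by rw [pow_mul, hK]⟩

/-- A permutation fixing `a` and preserving `t` commutes with the sum of the transpositions
exchanging `a` with an element of `t`. -/
theorem commute_sum_swap {α A : Type*} [DecidableEq α] [Ring A] (ρ : Perm α →* A)
    {t : Finset α} {a : α} {g : Perm α} (hga : g a = a) (hgt : ∀ i, g i ∈ t ↔ i ∈ t) :
    Commute (∑ i ∈ t, ρ (swap i a)) (ρ g) := by
  change _ * _ = _ * _
  rw [Finset.sum_mul, Finset.mul_sum]
  symm
  refine Finset.sum_equiv g (fun i ↦ (hgt i).symm) fun i _ ↦ ?_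
  rw [← map_mul, ← map_mul, mul_swap_eq_swap_mul, hga]

/-- In characteristic `ℓ`, a sum `X` of the transpositions exchanging `a` with the elements of a
finite set has `X ^ ℓ - X` nilpotent. -/
theorem isNilpotent_sum_swap_pow_sub (k : Type*) {α A : Type*} [DecidableEq α] [Field k] [Ring A]
    [Algebra k A] (ℓ : ℕ) [Fact ℓ.Prime] [CharP k ℓ] (ρ : Perm α →* A) (t : Finset α) {a : α}
    (ha : a ∉ t) :
    IsNilpotent ((∑ i ∈ t, ρ (swap i a)) ^ ℓ - ∑ i ∈ t, ρ (swap i a)) := by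
  induction t using Finset.induction_on generalizing a with
  | empty => simp [(Fact.out : ℓ.Prime).ne_zero]
  | insert b t hb ih =>
    have hab : a ≠ b := fun h ↦ ha (by simp [h])
    have hat : a ∉ t := fun h ↦ ha (by simp [h])
    refine isNilpotent_pow_sub_of_degenerate_hecke k ℓ (x := ∑ i ∈ t, ρ (swap i b))
      (s := ρ (swap b a)) ?_ ?_ ?_ (ih hb)
    · refine Commute.sum_left _ _ _ fun i hi ↦ (commute_sum_swap ρ ?_ fun j ↦ ?_).symm
      · exact swap_apply_of_ne_of_ne (ne_of_mem_of_not_mem hi hat).symm hab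
      · rcases eq_or_ne j i with rfl | hji
        · simp [hi]
        · rcases eq_or_ne j b with rfl | hjb
          · simp [hi]
          · rw [swap_apply_of_ne_of_ne hji hjb]
    · rw [← map_mul, swap_mul_self, map_one]
    · rw [Finset.sum_insert hb, add_comm, Finset.mul_sum, Finset.sum_mul]
      congr 1
      refine Finset.sum_congr rfl fun i hi ↦ ?_
      rw [← map_mul, ← map_mul, swap_mul_swap_mul_swap (ne_of_mem_of_not_mem hi hb)
        (ne_of_mem_of_not_mem hi hat), swap_comm]

/-- **Jucys–Murphy decomposition of restriction.**
Let `ℓ` be a prime, `k` a field of characteristic `ℓ` and `n = m + 1 ≥ 1`.  Let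
`S_n = Perm (Fin (m+1))`, with `S_{n-1}` the stabilizer of the last letter, and let
`X_n = (1,n) + ⋯ + (n-1,n)` be the Jucys–Murphy element.  Let `M` be a finite
dimensional `kS_n`-module, and `x_M` the `k`-linear operator on `M` given by `X_n`.
Then: (a) `x_M` commutes with the action of every element of `S_{n-1}`;
(b) `M` is the direct sum, over `a` in the prime subfield `F_ℓ ⊆ k`, of the generalized
eigenspaces `M_a = ⋃_r ker (x_M - a)^r` (so all generalized eigenvalues lie in `F_ℓ`);
(c) each `M_a` is an `S_{n-1}`-submodule of `M`. -/
theorem jucysMurphy_generalized_eigenspace_decomposition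
    (ℓ : ℕ) (hℓ : ℓ.Prime) (k : Type) [Field k] [CharP k ℓ] (m : ℕ)
    (M : Type) [AddCommGroup M] [Module k M] [FiniteDimensional k M]
    [DistribMulAction (Perm (Fin (m + 1))) M]
    [SMulCommClass (Perm (Fin (m + 1))) k M] :
    (∀ g : Perm (Fin (m + 1)), g (Fin.last m) = Fin.last m →
      Commute
        (∑ i : Fin m,
          DistribMulAction.toLinearMap k M (Equiv.swap (Fin.castSucc i) (Fin.last m)))
        (DistribMulAction.toLinearMap k M g)) ∧
    DirectSum.IsInternal (fun a : ZMod ℓ =>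
      Module.End.maxGenEigenspace
        (∑ i : Fin m,
          DistribMulAction.toLinearMap k M (Equiv.swap (Fin.castSucc i) (Fin.last m)))
        (ZMod.castHom (dvd_refl ℓ) k a)) ∧
    (∀ g : Perm (Fin (m + 1)), g (Fin.last m) = Fin.last m → ∀ a : ZMod ℓ,
      ∀ v ∈ Module.End.maxGenEigenspace
          (∑ i : Fin m,
            DistribMulAction.toLinearMap k M (Equiv.swap (Fin.castSucc i) (Fin.last m)))
          (ZMod.castHom (dvd_refl ℓ) k a),
        g • v ∈ Module.End.maxGenEigenspace
          (∑ i : Fin m,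
            DistribMulAction.toLinearMap k M (Equiv.swap (Fin.castSucc i) (Fin.last m)))
          (ZMod.castHom (dvd_refl ℓ) k a)) := by
  have : Fact ℓ.Prime := ⟨hℓ⟩
  set x := ∑ i : Fin m,
    DistribSMul.toLinearMap k M (Equiv.swap (Fin.castSucc i) (Fin.last m))
  have hxt : x = ∑ i ∈ Finset.univ.map Fin.castSuccEmb,
      DistribMulAction.toModuleEnd k M (Equiv.swap i (Fin.last m)) := by
    rw [Finset.sum_map]
    rfl
  have hlast (i : Fin (m + 1)) :
      i ∈ Finset.univ.map (Fin.castSuccEmb (n := m)) ↔ i ≠ Fin.last m := by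
    simp [Fin.exists_castSucc_eq]
  have hcomm (g : Perm (Fin (m + 1))) (hg : g (Fin.last m) = Fin.last m) :
      Commute x (DistribSMul.toLinearMap k M g) := by
    rw [hxt]
    refine commute_sum_swap (DistribMulAction.toModuleEnd k M) hg fun i ↦ ?_
    rw [hlast, hlast, not_iff_not, ← g.injective.eq_iff (a := i), hg]
  refine ⟨hcomm, isInternal_maxGenEigenspace_of_isNilpotent_pow_sub ℓ x ?_, fun g hg a v hv ↦
    Module.End.mapsTo_maxGenEigenspace_of_comm (hcomm g hg) _ hv⟩
  rw [hxt]
  exact isNilpotent_sum_swap_pow_sub k ℓ _ _ (by simp [hlast])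
end
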